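/- Fix an integer n ≥ 1. Let u, g₁, …, g_n be smooth real-valued functions of coordinates including (x, y, z, t_n), and assume g₁ = u_x and g_{k+1,z} = u_{yz} g_{k,x} − u_{zx} g_{k,y} for all 1 ≤ k ≤ n−1. For λ ∈ ℝ define T_n f = f_{t_n} − (λⁿ − Σ_{k=1}^{n} g_{k,y} λ^{n−k}) f_x − (Σ_{k=1}^{n} g_{k,x} λ^{n−k}) f_y and Z₁ f = λ f_z − u_{yz} f_x + u_{zx} f_y on smooth functions f. Then for every λ ∈ ℝ and every smooth f, T_n(Z₁ f) − Z₁(T_n f) = E_x f_y − E_y f_x, where E = u_{z t_n} + u_{xz} g_{n,y} − u_{yz} g_{n,x} is independent of λ. Consequently T_n and Z₁ commute for every λ ∈ ℝ if and only if ∂_x E = ∂_y E = 0. -/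

import Mathlib

/-- Partial derivative of `f` in the `i`-th coordinate direction. -/
noncomputable def pd {n : ℕ} (i : Fin n) (f : (Fin n → ℝ) → ℝ) : (Fin n → ℝ) → ℝ :=
  fun p => fderiv ℝ f p (Pi.single i 1)

/-- Coordinates: x = 0, y = 1, z = 2, t_n = 3.
`T_n f = f_{t_n} − (λⁿ − Σ_{k=1}^n g_{k,y} λ^{n−k}) f_x − (Σ_{k=1}^n g_{k,x} λ^{n−k}) f_y`. -/
noncomputable def Tn (n : ℕ) (g : ℕ → (Fin 4 → ℝ) → ℝ) (lam : ℝ)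
    (f : (Fin 4 → ℝ) → ℝ) : (Fin 4 → ℝ) → ℝ :=
  fun q => pd 3 f q
    - (lam ^ n - ∑ k ∈ Finset.Icc 1 n, pd 1 (g k) q * lam ^ (n - k)) * pd 0 f q
    - (∑ k ∈ Finset.Icc 1 n, pd 0 (g k) q * lam ^ (n - k)) * pd 1 f q

/-- `Z₁ f = λ f_z − u_{yz} f_x + u_{zx} f_y`. -/
noncomputable def Z1 (u : (Fin 4 → ℝ) → ℝ) (lam : ℝ) (f : (Fin 4 → ℝ) → ℝ) :
    (Fin 4 → ℝ) → ℝ :=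
  fun q => lam * pd 2 f q - pd 1 (pd 2 u) q * pd 0 f q + pd 0 (pd 2 u) q * pd 1 f q

/-- `E = u_{z t_n} + u_{xz} g_{n,y} − u_{yz} g_{n,x}`. -/
noncomputable def Ecomm (n : ℕ) (u : (Fin 4 → ℝ) → ℝ) (g : ℕ → (Fin 4 → ℝ) → ℝ) :
    (Fin 4 → ℝ) → ℝ :=
  fun q => pd 2 (pd 3 u) q + pd 0 (pd 2 u) q * pd 1 (g n) q
    - pd 1 (pd 2 u) q * pd 0 (g n) q

@[fun_prop]
theorem pd_contDiff {n : ℕ} (i : Fin n) {f : (Fin n → ℝ) → ℝ} (hf : ContDiff ℝ (⊤ : ℕ∞) f) :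
    ContDiff ℝ (⊤ : ℕ∞) (pd i f) :=
  (hf.fderiv_right (m := ((⊤ : ℕ∞) : WithTop ℕ∞)) (by simp)).clm_apply contDiff_const

theorem pd_add {n : ℕ} (i : Fin n) {f g : (Fin n → ℝ) → ℝ} (hf : ContDiff ℝ (⊤ : ℕ∞) f)
    (hg : ContDiff ℝ (⊤ : ℕ∞) g) (q : Fin n → ℝ) :
    pd i (fun p => f p + g p) q = pd i f q + pd i g q := by
  have h1 := (hf.differentiable (by simp) q).hasFDerivAt
  have h2 := (hg.differentiable (by simp) q).hasFDerivAt
  simp [pd, (h1.fun_add h2).fderiv]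

theorem pd_sub {n : ℕ} (i : Fin n) {f g : (Fin n → ℝ) → ℝ} (hf : ContDiff ℝ (⊤ : ℕ∞) f)
    (hg : ContDiff ℝ (⊤ : ℕ∞) g) (q : Fin n → ℝ) :
    pd i (fun p => f p - g p) q = pd i f q - pd i g q := by
  have h1 := (hf.differentiable (by simp) q).hasFDerivAt
  have h2 := (hg.differentiable (by simp) q).hasFDerivAt
  simp [pd, (h1.fun_sub h2).fderiv]

theorem pd_mul {n : ℕ} (i : Fin n) {f g : (Fin n → ℝ) → ℝ} (hf : ContDiff ℝ (⊤ : ℕ∞) f)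
    (hg : ContDiff ℝ (⊤ : ℕ∞) g) (q : Fin n → ℝ) :
    pd i (fun p => f p * g p) q = f q * pd i g q + g q * pd i f q := by
  have h1 := (hf.differentiable (by simp) q).hasFDerivAt
  have h2 := (hg.differentiable (by simp) q).hasFDerivAt
  simp [pd, (h1.fun_mul h2).fderiv]

theorem pd_const {n : ℕ} (i : Fin n) (c : ℝ) (q : Fin n → ℝ) :
    pd i (fun _ => c) q = 0 := by
  simp [pd]

theorem pd_sum {n : ℕ} (i : Fin n) {ι : Type*} (s : Finset ι) {f : ι → (Fin n → ℝ) → ℝ}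
    (hf : ∀ k, ContDiff ℝ (⊤ : ℕ∞) (f k)) (q : Fin n → ℝ) :
    pd i (fun p => ∑ k ∈ s, f k p) q = ∑ k ∈ s, pd i (f k) q := by
  have h := HasFDerivAt.fun_sum (u := s)
    fun k _ => ((hf k).differentiable (by simp) q).hasFDerivAt
  simp [pd, h.fderiv]

theorem pd_coord {n : ℕ} (i j : Fin n) (q : Fin n → ℝ) :
    pd i (fun p => p j) q = (Pi.single i 1 : Fin n → ℝ) j := by
  have h := hasFDerivAt_apply (𝕜 := ℝ) j q
  simp [pd, h.fderiv]

/-- Partial derivatives of a smooth function commute. -/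
theorem pd_comm {n : ℕ} (i j : Fin n) {f : (Fin n → ℝ) → ℝ} (hf : ContDiff ℝ (⊤ : ℕ∞) f) :
    pd i (pd j f) = pd j (pd i f) := by
  funext q
  have hd : DifferentiableAt ℝ (fderiv ℝ f) q :=
    (hf.fderiv_right (m := 1) (by norm_cast)).differentiable (by simp) q
  have key (a b : Fin n) : pd a (pd b f) q
      = fderiv ℝ (fderiv ℝ f) q (Pi.single a 1) (Pi.single b 1) := by
    have h := hd.hasFDerivAt.clm_apply
      (hasFDerivAt_const (Pi.single b 1 : Fin n → ℝ) q)
    unfold pd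
    rw [h.fderiv]
    simp
  rw [key, key]
  exact hf.contDiffAt.isSymmSndFDerivAt
    (by rw [minSmoothness_of_isRCLikeNormedField]; exact WithTop.coe_le_coe.2 (le_top (a := 2))) _ _

/-- The polynomial in `lam` with coefficients `g k` generating the potentials of `Tn`. -/
noncomputable def generatingSum (n : ℕ) (g : ℕ → (Fin 4 → ℝ) → ℝ) (lam : ℝ) :
    (Fin 4 → ℝ) → ℝ :=
  fun q => ∑ k ∈ Finset.Icc 1 n, g k q * lam ^ (n - k)

section

variable {n : ℕ} {g : ℕ → (Fin 4 → ℝ) → ℝ}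

theorem generatingSum_contDiff (hg : ∀ k, ContDiff ℝ (⊤ : ℕ∞) (g k)) (lam : ℝ) :
    ContDiff ℝ (⊤ : ℕ∞) (generatingSum n g lam) := by
  unfold generatingSum
  fun_prop

theorem pd_generatingSum (hg : ∀ k, ContDiff ℝ (⊤ : ℕ∞) (g k)) (lam : ℝ) (i : Fin 4)
    (q : Fin 4 → ℝ) :
    pd i (generatingSum n g lam) q = ∑ k ∈ Finset.Icc 1 n, pd i (g k) q * lam ^ (n - k) := by
  unfold generatingSum
  rw [pd_sum i _ (fun k => by fun_prop)]
  refine Finset.sum_congr rfl fun k _ => ?_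
  rw [pd_mul i (hg k) contDiff_const, pd_const]
  ring

theorem Tn_eq_generatingSum (hg : ∀ k, ContDiff ℝ (⊤ : ℕ∞) (g k)) (lam : ℝ)
    (f : (Fin 4 → ℝ) → ℝ) :
    Tn n g lam f = fun q => pd 3 f q - (lam ^ n - pd 1 (generatingSum n g lam) q) * pd 0 f q
      - pd 0 (generatingSum n g lam) q * pd 1 f q := by
  funext q
  simp only [Tn, pd_generatingSum hg]

/-- A Horner-type telescoping of sums whose coefficients satisfy `c (k + 1) = d k`. -/
theorem mul_sum_Icc_pow_of_recursion {m : ℕ} (hm : 1 ≤ m) (lam : ℝ) (c d : ℕ → ℝ)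
    (h : ∀ k, 1 ≤ k → k + 1 ≤ m → c (k + 1) = d k) :
    lam * ∑ k ∈ Finset.Icc 1 m, c k * lam ^ (m - k)
      = lam ^ m * c 1 + ∑ k ∈ Finset.Icc 1 m, d k * lam ^ (m - k) - d m := by
  induction m, hm using Nat.le_induction with
  | base => simp
  | succ m hm ih =>
    have hstep (a : ℕ → ℝ) : ∑ k ∈ Finset.Icc 1 (m + 1), a k * lam ^ (m + 1 - k)
        = lam * ∑ k ∈ Finset.Icc 1 m, a k * lam ^ (m - k) + a (m + 1) := by
      rw [Finset.sum_Icc_succ_top (by omega), Finset.mul_sum]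
      congr 1
      · refine Finset.sum_congr rfl fun k hk => ?_
        rw [Nat.succ_sub (Finset.mem_Icc.mp hk).2, pow_succ]
        ring
      · simp
    rw [hstep, hstep, ih fun k h1 h2 => h k h1 (by omega), h m hm le_rfl]
    ring

/-- The recursion makes `Ecomm` the `lam`-independent value of the Hamiltonian of `[Tn, Z1]`. -/
theorem Ecomm_eq_generatingSum {u : (Fin 4 → ℝ) → ℝ} (hn : 1 ≤ n)
    (hu : ContDiff ℝ (⊤ : ℕ∞) u) (hg : ∀ k, ContDiff ℝ (⊤ : ℕ∞) (g k)) (hg1 : g 1 = pd 0 u)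
    (hrec : ∀ k : ℕ, 1 ≤ k → k + 1 ≤ n → ∀ q,
      pd 2 (g (k + 1)) q = pd 1 (pd 2 u) q * pd 0 (g k) q
        - pd 0 (pd 2 u) q * pd 1 (g k) q) (lam : ℝ) :
    Ecomm n u g = fun q => pd 3 (pd 2 u) q - lam ^ n * pd 0 (pd 2 u) q
      + lam * pd 2 (generatingSum n g lam) q
      - (pd 0 (generatingSum n g lam) q * pd 1 (pd 2 u) q
        - pd 1 (generatingSum n g lam) q * pd 0 (pd 2 u) q) := by
  funext q
  have h := mul_sum_Icc_pow_of_recursion hn lam (fun k => pd 2 (g k) q)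
    (fun k => pd 1 (pd 2 u) q * pd 0 (g k) q - pd 0 (pd 2 u) q * pd 1 (g k) q)
    (fun k h1 h2 => hrec k h1 h2 q)
  have hsum : ∑ k ∈ Finset.Icc 1 n,
      (pd 1 (pd 2 u) q * pd 0 (g k) q - pd 0 (pd 2 u) q * pd 1 (g k) q) * lam ^ (n - k)
      = pd 1 (pd 2 u) q * pd 0 (generatingSum n g lam) q
        - pd 0 (pd 2 u) q * pd 1 (generatingSum n g lam) q := by
    rw [pd_generatingSum hg, pd_generatingSum hg, Finset.mul_sum, Finset.mul_sum,
      ← Finset.sum_sub_distrib]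
    exact Finset.sum_congr rfl fun k _ => by ring
  simp only [hsum, hg1, ← pd_generatingSum hg] at h
  rw [pd_comm 2 0 hu] at h
  simp only [Ecomm]
  rw [pd_comm 2 3 hu]
  linear_combination -h

end

/-- under the hierarchy recursions `g₁ = u_x`,
`g_{k+1,z} = u_{yz} g_{k,x} − u_{zx} g_{k,y}` (1 ≤ k ≤ n−1), one has
`T_n(Z₁ f) − Z₁(T_n f) = E_x f_y − E_y f_x` with `E` independent of `λ`;
consequently `T_n` and `Z₁` commute for every `λ` iff `∂_x E = ∂_y E = 0`. -/
theorem stmt16 (n : ℕ) (hn : 1 ≤ n) (u : (Fin 4 → ℝ) → ℝ)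
    (g : ℕ → (Fin 4 → ℝ) → ℝ) (hu : ContDiff ℝ (⊤ : ℕ∞) u) (hg : ∀ k, ContDiff ℝ (⊤ : ℕ∞) (g k))
    (hg1 : g 1 = pd 0 u)
    (hrec : ∀ k : ℕ, 1 ≤ k → k + 1 ≤ n → ∀ q,
      pd 2 (g (k + 1)) q = pd 1 (pd 2 u) q * pd 0 (g k) q
        - pd 0 (pd 2 u) q * pd 1 (g k) q) :
    (∀ lam : ℝ, ∀ f : (Fin 4 → ℝ) → ℝ, ContDiff ℝ (⊤ : ℕ∞) f → ∀ q,
        Tn n g lam (Z1 u lam f) q - Z1 u lam (Tn n g lam f) q =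
          pd 0 (Ecomm n u g) q * pd 1 f q - pd 1 (Ecomm n u g) q * pd 0 f q)
    ∧ ((∀ lam : ℝ, ∀ f : (Fin 4 → ℝ) → ℝ, ContDiff ℝ (⊤ : ℕ∞) f → ∀ q,
          Tn n g lam (Z1 u lam f) q = Z1 u lam (Tn n g lam f) q)
        ↔ (∀ q, pd 0 (Ecomm n u g) q = 0 ∧ pd 1 (Ecomm n u g) q = 0)) := by
  have comm (lam : ℝ) (f : (Fin 4 → ℝ) → ℝ) (hf : ContDiff ℝ (⊤ : ℕ∞) f) (q : Fin 4 → ℝ) :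
      Tn n g lam (Z1 u lam f) q - Z1 u lam (Tn n g lam f) q =
        pd 0 (Ecomm n u g) q * pd 1 f q - pd 1 (Ecomm n u g) q * pd 0 f q := by
    have hG := generatingSum_contDiff (n := n) hg lam
    have hw : ContDiff ℝ (⊤ : ℕ∞) (pd 2 u) := pd_contDiff 2 hu
    rw [Ecomm_eq_generatingSum hn hu hg hg1 hrec lam, Tn_eq_generatingSum hg,
      Tn_eq_generatingSum hg]
    unfold Z1
    generalize generatingSum n g lam = G at hG
    generalize pd 2 u = w at hw
    simp (disch := fun_prop) only [pd_add, pd_sub, pd_mul, pd_const]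
    have hc (i j : Fin 4) := pd_comm i j hf
    have hcG (i j : Fin 4) := pd_comm i j hG
    have hcw (i j : Fin 4) := pd_comm i j hw
    rw [hc 3 2, hc 3 0, hc 3 1, hc 2 0, hc 2 1, hc 1 0, hcG 2 0, hcG 2 1, hcG 1 0,
      hcw 3 0, hcw 3 1, hcw 1 0]
    ring
  refine ⟨comm, fun h q => ?_, fun h lam f hf q => ?_⟩
  · have hx := comm 0 (fun p => p 0) (by fun_prop) q
    have hy := comm 0 (fun p => p 1) (by fun_prop) q
    rw [h 0 _ (by fun_prop) q, sub_self] at hx hy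
    simp [pd_coord] at hx hy
    exact ⟨hy.symm, hx⟩
  · rw [← sub_eq_zero, comm lam f hf q, (h q).1, (h q).2]
    ring
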